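/- Let W be a classical channel from a finite alphabet 𝒳 to a finite alphabet 𝒴, and let r ≥ 0. Then for every n ∈ ℕ and every α ∈ [1/2, 1], one has 1 − ε^NS(W^⊗n, e^{nr}) ≤ exp(−n·((1−α)/α)·(I_α(W) − r)). Consequently liminf_{n→∞} −(1/n) log(1 − ε^NS(W^⊗n, e^{nr})) ≥ sup_{1/2 ≤ α ≤ 1} ((1−α)/α)(I_α(W) − r). -/

import Mathlib

noncomputable section
open scoped BigOperators
open Classical
open scoped ComplexOrder

namespace ChannelSim

/-! ### Classical definitions -/

/-- A probability distribution on a finite type. -/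
def IsProbDist {Y : Type*} [Fintype Y] (p : Y → ℝ) : Prop :=
  (∀ y, 0 ≤ p y) ∧ ∑ y, p y = 1

/-- A classical channel: a stochastic matrix, i.e. each row is a probability distribution. -/
def IsChannel {X Y : Type*} [Fintype Y] (W : X → Y → ℝ) : Prop :=
  ∀ x, IsProbDist (W x)

/-- The `n`-fold product channel `W^{⊗n}`. -/
def prodChannel {X Y : Type*} (W : X → Y → ℝ) (n : ℕ) :
    (Fin n → X) → (Fin n → Y) → ℝ :=
  fun xs ys => ∏ i, W (xs i) (ys i)

/-- The `n`-fold product distribution `q^{⊗n}`. -/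
def prodDist {Y : Type*} (q : Y → ℝ) (n : ℕ) : (Fin n → Y) → ℝ :=
  fun ys => ∏ i, q (ys i)

/-- Fidelity of probability distributions on a finite type. -/
def cFid {Y : Type*} [Fintype Y] (p q : Y → ℝ) : ℝ :=
  (∑ y, Real.sqrt (p y * q y)) ^ 2

/-- Purified distance of probability distributions on a finite type. -/
def cPD {Y : Type*} [Fintype Y] (p q : Y → ℝ) : ℝ :=
  Real.sqrt (1 - cFid p q)

/-- Non-signaling simulation error of a classical channel with communication size `M`. -/
def cEpsNS {X Y : Type*} [Fintype X] [Fintype Y] (W : X → Y → ℝ) (M : ℝ) : ℝ :=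
  sInf { e : ℝ | ∃ (W' : X → Y → ℝ) (q : Y → ℝ), IsChannel W' ∧ IsProbDist q ∧
    (∀ x y, W' x y ≤ M * q y) ∧ e = ⨆ x, cPD (W x) (W' x) }

/-- Shared-randomness simulation error of a classical channel with communication size `M`. -/
def cEpsSR {X Y : Type*} [Fintype X] [Fintype Y] (W : X → Y → ℝ) (M : ℝ) : ℝ :=
  sInf { e : ℝ | ∃ (k m : ℕ) (pS : Fin k → ℝ) (Enc : X → Fin k → Fin m → ℝ)
    (Dec : Fin m → Fin k → Y → ℝ),
    IsProbDist pS ∧ (∀ x s, IsProbDist (Enc x s)) ∧ (∀ i s, IsProbDist (Dec i s)) ∧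
    (m : ℝ) ≤ M ∧
    e = ⨆ x, cPD (W x) (fun y => ∑ s, pS s * ∑ i, Enc x s i * Dec i s y) }

/-- Classical Rényi divergence of order `α > 0`, with values in the extended reals:
the Kullback–Leibler divergence at `α = 1`, and `+∞` whenever `α > 1` (or `α = 1`)
and the support of `p` is not contained in that of `q`. -/
def cRenyiD {Y : Type*} [Fintype Y] (α : ℝ) (p q : Y → ℝ) : EReal :=
  if α = 1 then
    (if ∀ y, q y = 0 → p y = 0 then
      ((∑ y, p y * Real.log (p y / q y) : ℝ) : EReal) else (⊤ : EReal))
  else if 1 < α ∧ ¬ (∀ y, q y = 0 → p y = 0) then (⊤ : EReal)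
  else (((α - 1)⁻¹ * Real.log (∑ y, p y ^ α * q y ^ (1 - α)) : ℝ) : EReal)

/-- Rényi mutual information `I_α(W) = inf_q sup_x D_α(W(·|x)‖q)` of a classical channel. -/
def cRenyiMI {X Y : Type*} [Fintype X] [Fintype Y] (α : ℝ) (W : X → Y → ℝ) : EReal :=
  ⨅ q : {q : Y → ℝ // IsProbDist q}, ⨆ x, cRenyiD α (W x) q.1

/-- Kullback–Leibler divergence (real-valued formula, valid on matching supports). -/
def cKL {Y : Type*} [Fintype Y] (p q : Y → ℝ) : ℝ :=
  ∑ y, p y * Real.log (p y / q y)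

/-- Relative-entropy variance (real-valued formula, valid on matching supports). -/
def cVar {Y : Type*} [Fintype Y] (p q : Y → ℝ) : ℝ :=
  (∑ y, p y * (Real.log (p y / q y)) ^ 2) - (cKL p q) ^ 2

/-- The empirical type of a word `xs ∈ X^n`. -/
def empType {X : Type*} [Fintype X] {n : ℕ} (xs : Fin n → X) : X → ℝ :=
  fun x => (Finset.univ.filter fun i => xs i = x).card / n

/-! ### Quantum definitions -/

/-- A density matrix: positive semidefinite with unit trace. -/
def IsDensity {n : Type*} [Fintype n] [DecidableEq n] (ρ : Matrix n n ℂ) : Prop :=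
  ρ.PosSemidef ∧ ρ.trace = 1

/-- Functional calculus for Hermitian matrices (junk value `0` on non-Hermitian input). -/
def matFun {n : Type*} [Fintype n] [DecidableEq n] (f : ℝ → ℝ) (A : Matrix n n ℂ) :
    Matrix n n ℂ :=
  if hA : A.IsHermitian then
    (hA.eigenvectorUnitary : Matrix n n ℂ) *
      Matrix.diagonal (fun i => ((f (hA.eigenvalues i)) : ℂ)) *
      (star (hA.eigenvectorUnitary : Matrix n n ℂ))
  else 0

/-- Fidelity of density matrices: `F(ρ,σ) = (Tr √(√ρ σ √ρ))²`. -/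
def qFid {n : Type*} [Fintype n] [DecidableEq n] (ρ σ : Matrix n n ℂ) : ℝ :=
  ((matFun Real.sqrt (matFun Real.sqrt ρ * σ * matFun Real.sqrt ρ)).trace).re ^ 2

/-- Purified distance of density matrices. -/
def qPD {n : Type*} [Fintype n] [DecidableEq n] (ρ σ : Matrix n n ℂ) : ℝ :=
  Real.sqrt (1 - qFid ρ σ)

/-- Non-signaling simulation error of a classical-quantum channel with communication size `M`. -/
def qEpsNS {X B : Type*} [Fintype X] [Fintype B] [DecidableEq B]
    (W : X → Matrix B B ℂ) (M : ℝ) : ℝ :=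
  sInf { e : ℝ | ∃ (W' : X → Matrix B B ℂ) (σ : Matrix B B ℂ),
    (∀ x, IsDensity (W' x)) ∧ IsDensity σ ∧ (∀ x, (M • σ - W' x).PosSemidef) ∧
    e = ⨆ x, qPD (W x) (W' x) }

/-- Support inclusion `supp ρ ⊆ supp σ` for positive semidefinite matrices, expressed
via kernels: every vector killed by `σ` is killed by `ρ`. -/
def suppLE {n : Type*} [Fintype n] (ρ σ : Matrix n n ℂ) : Prop :=
  ∀ v, σ.mulVec v = 0 → ρ.mulVec v = 0

/-- Umegaki relative entropy `D(ρ‖σ) = Tr ρ (log ρ − log σ)` (logarithms on supports;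
real-valued formula, valid when `supp ρ ⊆ supp σ`). -/
def relEntQ {n : Type*} [Fintype n] [DecidableEq n] (ρ σ : Matrix n n ℂ) : ℝ :=
  ((ρ * (matFun Real.log ρ - matFun Real.log σ)).trace).re

/-- Quantum relative-entropy variance `Tr ρ (log ρ − log σ)² − D(ρ‖σ)²`. -/
def varQ {n : Type*} [Fintype n] [DecidableEq n] (ρ σ : Matrix n n ℂ) : ℝ :=
  ((ρ * (matFun Real.log ρ - matFun Real.log σ) ^ 2).trace).re - (relEntQ ρ σ) ^ 2

/-- Sandwiched Rényi divergence of order `α`, valued in the extended reals: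
`D̃_α(ρ‖σ) = (α−1)⁻¹ log Tr (σ^{(1−α)/(2α)} ρ σ^{(1−α)/(2α)})^α`, with the Umegaki relative
entropy at `α = 1`, and `+∞` when `α ≥ 1` and `supp ρ ⊄ supp σ`, or `α < 1` and `ρσ = 0`. -/
def sandD {n : Type*} [Fintype n] [DecidableEq n] (α : ℝ) (ρ σ : Matrix n n ℂ) : EReal :=
  if α = 1 then (if suppLE ρ σ then ((relEntQ ρ σ : ℝ) : EReal) else (⊤ : EReal))
  else if (1 < α ∧ ¬ suppLE ρ σ) ∨ (α < 1 ∧ ρ * σ = 0) then (⊤ : EReal)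
  else (((α - 1)⁻¹ * Real.log
      (((matFun (fun t => t ^ α)
        (matFun (fun t => t ^ ((1 - α) / (2 * α))) σ * ρ *
          matFun (fun t => t ^ ((1 - α) / (2 * α))) σ)).trace).re) : ℝ) : EReal)

/-- Sandwiched Rényi mutual information `Ĩ_α(W) = inf_σ sup_x D̃_α(W_x‖σ)` of a CQ channel. -/
def sandMI {X B : Type*} [Fintype X] [Fintype B] [DecidableEq B]
    (α : ℝ) (W : X → Matrix B B ℂ) : EReal :=
  ⨅ σ : {σ : Matrix B B ℂ // IsDensity σ}, ⨆ x, sandD α (W x) σ.1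

/-- `n`-fold tensor power `ρ^{⊗n}` of a matrix, realized on the index set `Fin n → B`. -/
def tensPow {B : Type*} (ρ : Matrix B B ℂ) (n : ℕ) :
    Matrix (Fin n → B) (Fin n → B) ℂ :=
  Matrix.of fun a b => ∏ i, ρ (a i) (b i)

/-- Tensor product `V_1 ⊗ ⋯ ⊗ V_k` of a family of matrices. -/
def tensProd {B : Type*} {k : ℕ} (V : Fin k → Matrix B B ℂ) :
    Matrix (Fin k → B) (Fin k → B) ℂ :=
  Matrix.of fun a b => ∏ i, V i (a i) (b i)

/-- The `n`-fold product CQ channel `W^{⊗n}`. -/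
def cqPow {X B : Type*} (W : X → Matrix B B ℂ) (n : ℕ) :
    (Fin n → X) → Matrix (Fin n → B) (Fin n → B) ℂ :=
  fun xs => Matrix.of fun a b => ∏ i, W (xs i) (a i) (b i)

/-- Minimal positive eigenvalue of a Hermitian matrix (junk value `0` otherwise). -/
def minPosEig {n : Type*} [Fintype n] [DecidableEq n] (A : Matrix n n ℂ) : ℝ :=
  if hA : A.IsHermitian then sInf {t : ℝ | 0 < t ∧ ∃ i, hA.eigenvalues i = t} else 0

/-- Extended-real exponential, sending `⊥ = −∞` to `0`. -/
def expE (x : EReal) : ℝ := if x = ⊥ then 0 else Real.exp x.toReal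


/-- The joint classical–quantum state `W∘p = Σ_x p(x) |x⟩⟨x| ⊗ W_x` as a block-diagonal
matrix on `ℂ^{|X|} ⊗ B`. -/
def cqJoint {X B : Type*} [DecidableEq X] (p : X → ℝ) (W : X → Matrix B B ℂ) :
    Matrix (X × B) (X × B) ℂ :=
  Matrix.of fun a b => if a.1 = b.1 then (p a.1 : ℂ) * W a.1 a.2 b.2 else 0

end ChannelSim
namespace ChannelSim

/-- Minkowski's inequality for a finite family of nonnegative functions. -/
theorem Lp_sum_le {ι Z : Type*} [Fintype ι] [Fintype Z] {t : ℝ} (ht : 1 ≤ t)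
    (f : ι → Z → ℝ) (hf : ∀ i z, 0 ≤ f i z) :
    (∑ z, (∑ i, f i z) ^ t) ^ (1 / t) ≤ ∑ i, (∑ z, f i z ^ t) ^ (1 / t) := by
  have ht0 : t ≠ 0 := by positivity
  have key := Finset.le_sum_of_subadditive
    (fun g : Z → ℝ => (∑ z, |g z| ^ t) ^ (1 / t))
    (by simp [Real.zero_rpow ht0, Real.zero_rpow (inv_ne_zero ht0)])
    (fun g h => Real.Lp_add_le Finset.univ g h ht) Finset.univ f
  simpa only [Finset.sum_apply, abs_of_nonneg (Finset.sum_nonneg fun i _ => hf i _),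
    abs_of_nonneg (hf _ _)] using key

section SingleLetter

variable {X Y : Type*} [Fintype X] [Fintype Y]

theorem IsProbDist.nonempty {p : Y → ℝ} (hp : IsProbDist p) : Nonempty Y := by
  by_contra h
  rw [not_nonempty_iff] at h
  simpa using hp.2

theorem IsProbDist.le_one {p : Y → ℝ} (hp : IsProbDist p) (y : Y) : p y ≤ 1 :=
  hp.2 ▸ Finset.single_le_sum (fun y _ => hp.1 y) (Finset.mem_univ y)

theorem isProbDist_uniform [Nonempty Y] :
    IsProbDist (fun _ : Y => (Fintype.card Y : ℝ)⁻¹) :=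
  ⟨fun _ => by positivity, by simp⟩

theorem cRenyiD_of_lt_one {α : ℝ} (hα : α < 1) (p q : Y → ℝ) :
    cRenyiD α p q =
      (((α - 1)⁻¹ * Real.log (∑ y, p y ^ α * q y ^ (1 - α)) : ℝ) : EReal) := by
  rw [cRenyiD, if_neg hα.ne, if_neg fun h => h.1.not_gt hα]

theorem cRenyiD_nonneg {α : ℝ} (hα0 : 0 ≤ α) (hα : α < 1) {p q : Y → ℝ}
    (hp : IsProbDist p) (hq : IsProbDist q) : 0 ≤ cRenyiD α p q := by
  rw [cRenyiD_of_lt_one hα]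
  have hle : ∑ y, p y ^ α * q y ^ (1 - α) ≤ 1 := calc
    ∑ y, p y ^ α * q y ^ (1 - α) ≤ ∑ y, (α * p y + (1 - α) * q y) :=
      Finset.sum_le_sum fun y _ => Real.geom_mean_le_arith_mean2_weighted hα0
        (sub_nonneg.2 hα.le) (hp.1 y) (hq.1 y) (by ring)
    _ = 1 := by rw [Finset.sum_add_distrib, ← Finset.mul_sum, ← Finset.mul_sum, hp.2, hq.2]; ring
  have h0 : 0 ≤ ∑ y, p y ^ α * q y ^ (1 - α) := Finset.sum_nonneg fun y _ =>
    mul_nonneg (Real.rpow_nonneg (hp.1 y) _) (Real.rpow_nonneg (hq.1 y) _)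
  exact_mod_cast mul_nonneg_of_nonpos_of_nonpos (inv_nonpos.2 (by linarith))
    (Real.log_nonpos h0 hle)

theorem cRenyiMI_nonneg [Nonempty X] {α : ℝ} (hα0 : 0 ≤ α) (hα : α < 1) {W : X → Y → ℝ}
    (hW : IsChannel W) : 0 ≤ cRenyiMI α W :=
  le_iInf fun q => (cRenyiD_nonneg hα0 hα (hW (Classical.arbitrary X)) q.2).trans
    (le_iSup (fun x => cRenyiD α (W x) q.1) _)

theorem exists_sum_le_exp_cRenyiMI [Nonempty X] {α : ℝ} (hα0 : 0 ≤ α) (hα : α < 1)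
    {W : X → Y → ℝ} (hW : IsChannel W) {q : Y → ℝ} (hq : IsProbDist q) :
    ∃ x, ∑ y, W x y ^ α * q y ^ (1 - α) ≤
      Real.exp (-(1 - α) * (cRenyiMI α W).toReal) := by
  obtain ⟨x, hx⟩ := exists_eq_ciSup_of_finite (f := fun x => cRenyiD α (W x) q)
  refine ⟨x, ?_⟩
  have hI : cRenyiMI α W ≤ cRenyiD α (W x) q := by
    rw [hx]
    exact iInf_le (fun q : {q : Y → ℝ // IsProbDist q} => ⨆ x, cRenyiD α (W x) q.1) ⟨q, hq⟩
  rw [cRenyiD_of_lt_one hα] at hI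
  have hI' := EReal.toReal_le_toReal hI
    (ne_bot_of_le_ne_bot (EReal.zero_ne_bot) (cRenyiMI_nonneg hα0 hα hW)) (EReal.coe_ne_top _)
  rw [EReal.toReal_coe] at hI'
  have h0 : 0 ≤ ∑ y, W x y ^ α * q y ^ (1 - α) := Finset.sum_nonneg fun y _ =>
    mul_nonneg (Real.rpow_nonneg ((hW x).1 y) _) (Real.rpow_nonneg (hq.1 y) _)
  rcases h0.eq_or_lt with h | h
  · rw [← h]; positivity
  · rw [← Real.log_le_iff_le_exp h]
    have h1 : 0 < 1 - α := by linarith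
    have := mul_le_mul_of_nonneg_left hI' h1.le
    have h2 : (1 - α) * ((α - 1)⁻¹ * Real.log (∑ y, W x y ^ α * q y ^ (1 - α))) =
        -Real.log (∑ y, W x y ^ α * q y ^ (1 - α)) := by
      have : α - 1 ≠ 0 := by linarith
      field_simp
      ring
    linarith

/-- The homogeneous form of `exists_sum_le_exp_cRenyiMI`. -/
theorem exists_sum_le_of_nonneg [Nonempty X] {α : ℝ} (hα0 : 0 ≤ α) (hα : α < 1)
    {W : X → Y → ℝ} (hW : IsChannel W) {q : Y → ℝ} (hq : ∀ y, 0 ≤ q y) :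
    ∃ x, ∑ y, W x y ^ α * q y ^ (1 - α) ≤
      Real.exp (-(1 - α) * (cRenyiMI α W).toReal) * (∑ y, q y) ^ (1 - α) := by
  have h1 : 1 - α ≠ 0 := by linarith
  have hs0 : 0 ≤ ∑ y, q y := Finset.sum_nonneg fun y _ => hq y
  rcases hs0.eq_or_lt with h | h
  · have hz : ∀ y, q y = 0 := fun y =>
      (Finset.sum_eq_zero_iff_of_nonneg fun y _ => hq y).1 h.symm y (Finset.mem_univ y)
    exact ⟨Classical.arbitrary X, by simp [hz, Real.zero_rpow h1]⟩
  · obtain ⟨x, hx⟩ := exists_sum_le_exp_cRenyiMI hα0 hα hW (q := fun y => q y / ∑ z, q z)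
      ⟨fun y => div_nonneg (hq y) h.le, by rw [← Finset.sum_div, div_self h.ne']⟩
    refine ⟨x, ?_⟩
    rw [← div_le_iff₀ (by positivity), Finset.sum_div]
    simpa only [Real.div_rpow (hq _) h.le, mul_div_assoc] using hx

/-- Hölder bound on the fidelity by the Rényi overlap of order `α ∈ [1/2, 1)`. -/
theorem cFid_le {α M : ℝ} (hα2 : 1 / 2 ≤ α) (hα : α < 1) (hM : 0 ≤ M) {p w q : Y → ℝ}
    (hp : ∀ y, 0 ≤ p y) (hw : IsProbDist w) (hq : ∀ y, 0 ≤ q y) (hwq : ∀ y, w y ≤ M * q y) :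
    cFid p w ≤ (M ^ (1 - α) * ∑ y, p y ^ α * q y ^ (1 - α)) ^ (1 / α) := by
  have hα0 : 0 < α := by linarith
  have h1 : 0 < 1 - α := by linarith
  have hsqrt : ∀ y, Real.sqrt (p y * w y) = w y * Real.sqrt (p y / w y) := by
    intro y
    rcases (hw.1 y).eq_or_lt with h | h
    · simp [← h]
    · rw [show p y * w y = w y ^ 2 * (p y / w y) by field_simp, Real.sqrt_mul (by positivity),
        Real.sqrt_sq h.le]
  have hpow : ∀ y, w y * Real.sqrt (p y / w y) ^ (2 * α) = p y ^ α * w y ^ (1 - α) := by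
    intro y
    rcases (hw.1 y).eq_or_lt with h | h
    · simp [← h, Real.zero_rpow h1.ne']
    · rw [Real.sqrt_eq_rpow, ← Real.rpow_mul (div_nonneg (hp y) h.le),
        show 1 / 2 * (2 * α) = α by ring, Real.div_rpow (hp y) h.le, Real.rpow_sub h,
        Real.rpow_one]
      ring
  have hH := Real.inner_le_weight_mul_Lp_of_nonneg Finset.univ (p := 2 * α) (by linarith)
    w (fun y => Real.sqrt (p y / w y)) hw.1 fun y => Real.sqrt_nonneg _
  simp only [← hsqrt, hpow, hw.2, Real.one_rpow, one_mul] at hH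
  have hle : ∑ y, p y ^ α * w y ^ (1 - α) ≤ M ^ (1 - α) * ∑ y, p y ^ α * q y ^ (1 - α) := by
    rw [Finset.mul_sum]
    refine Finset.sum_le_sum fun y _ => ?_
    calc p y ^ α * w y ^ (1 - α) ≤ p y ^ α * (M * q y) ^ (1 - α) :=
          mul_le_mul_of_nonneg_left (Real.rpow_le_rpow (hw.1 y) (hwq y) h1.le)
            (Real.rpow_nonneg (hp y) _)
      _ = _ := by rw [Real.mul_rpow hM (hq y)]; ring
  have h0 : 0 ≤ ∑ y, p y ^ α * w y ^ (1 - α) := Finset.sum_nonneg fun y _ =>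
    mul_nonneg (Real.rpow_nonneg (hp y) _) (Real.rpow_nonneg (hw.1 y) _)
  calc cFid p w ≤ ((∑ y, p y ^ α * w y ^ (1 - α)) ^ (2 * α)⁻¹) ^ 2 :=
        pow_le_pow_left₀ (Finset.sum_nonneg fun y _ => Real.sqrt_nonneg _) hH 2
    _ = (∑ y, p y ^ α * w y ^ (1 - α)) ^ (1 / α) := by
        rw [← Real.rpow_natCast, ← Real.rpow_mul h0]
        congr 1
        push_cast
        field_simp
    _ ≤ _ := Real.rpow_le_rpow h0 hle (by positivity)

theorem one_sub_cPD_le_cFid {p q : Y → ℝ} (hle : cFid p q ≤ 1) : 1 - cPD p q ≤ cFid p q := by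
  have h0 : 0 ≤ cFid p q := sq_nonneg _
  have : 1 - cFid p q ≤ cPD p q := Real.le_sqrt_of_sq_le (by nlinarith)
  linarith

theorem cFid_le_one {p q : Y → ℝ} (hp : IsProbDist p) (hq : IsProbDist q) : cFid p q ≤ 1 := by
  have := cFid_le (α := 1 / 2) (M := 1) le_rfl (by norm_num) zero_le_one hp.1 hq hq.1
    (fun y => (one_mul (q y)).ge)
  have hle : ∑ y, p y ^ (1 / 2 : ℝ) * q y ^ (1 - 1 / 2 : ℝ) ≤ 1 := calc
    _ ≤ ∑ y, ((1 / 2) * p y + (1 - 1 / 2) * q y) :=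
      Finset.sum_le_sum fun y _ => Real.geom_mean_le_arith_mean2_weighted (by norm_num)
        (by norm_num) (hp.1 y) (hq.1 y) (by norm_num)
    _ = 1 := by
      rw [Finset.sum_add_distrib, ← Finset.mul_sum, ← Finset.mul_sum, hp.2, hq.2]; norm_num
  refine this.trans (Real.rpow_le_one ?_ ?_ (by norm_num))
  · exact mul_nonneg (by simp) (Finset.sum_nonneg fun y _ =>
      mul_nonneg (Real.rpow_nonneg (hp.1 y) _) (Real.rpow_nonneg (hq.1 y) _))
  · simpa using hle

theorem inv_card_le_cFid_uniform {p : Y → ℝ} (hp : IsProbDist p) :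
    (Fintype.card Y : ℝ)⁻¹ ≤ cFid p (fun _ => (Fintype.card Y : ℝ)⁻¹) := by
  have hle : Real.sqrt (Fintype.card Y : ℝ)⁻¹ ≤
      ∑ y, Real.sqrt (p y * (Fintype.card Y : ℝ)⁻¹) := by
    calc Real.sqrt (Fintype.card Y : ℝ)⁻¹
        = ∑ y, p y * Real.sqrt (Fintype.card Y : ℝ)⁻¹ := by
          rw [← Finset.sum_mul, hp.2, one_mul]
      _ ≤ _ := Finset.sum_le_sum fun y _ => by
          rw [Real.sqrt_mul (hp.1 y)]
          refine mul_le_mul_of_nonneg_right (Real.le_sqrt_of_sq_le ?_) (Real.sqrt_nonneg _)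
          nlinarith [hp.1 y, hp.le_one y]
  calc (Fintype.card Y : ℝ)⁻¹ = Real.sqrt (Fintype.card Y : ℝ)⁻¹ ^ 2 :=
        (Real.sq_sqrt (by positivity)).symm
    _ ≤ _ := pow_le_pow_left₀ (Real.sqrt_nonneg _) hle 2

theorem cEpsNS_nonneg (W : X → Y → ℝ) (M : ℝ) : 0 ≤ cEpsNS W M := by
  refine Real.sInf_nonneg ?_
  rintro e ⟨W', q, -, -, -, rfl⟩
  exact Real.iSup_nonneg fun x => Real.sqrt_nonneg _

theorem exists_uniform_mem {X Y : Type*} [Fintype Y] [Nonempty Y] (W : X → Y → ℝ) {M : ℝ} (hM : 1 ≤ M) :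
    ∃ (W' : X → Y → ℝ) (q : Y → ℝ), IsChannel W' ∧ IsProbDist q ∧
      (∀ x y, W' x y ≤ M * q y) ∧
      (⨆ x, cPD (W x) (fun _ => (Fintype.card Y : ℝ)⁻¹)) = ⨆ x, cPD (W x) (W' x) :=
  ⟨fun _ _ => (Fintype.card Y : ℝ)⁻¹, fun _ => (Fintype.card Y : ℝ)⁻¹,
    fun _ => isProbDist_uniform, isProbDist_uniform,
    fun _ _ => le_mul_of_one_le_left (by positivity) hM, rfl⟩

theorem cEpsNS_le [Nonempty X] [Nonempty Y] {W : X → Y → ℝ} (hW : IsChannel W) {M : ℝ}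
    (hM : 1 ≤ M) : (2 * Fintype.card Y : ℝ)⁻¹ ≤ 1 - cEpsNS W M := by
  have hle : cEpsNS W M ≤ ⨆ x, cPD (W x) (fun _ => (Fintype.card Y : ℝ)⁻¹) := by
    refine csInf_le ⟨0, ?_⟩ (exists_uniform_mem W hM)
    rintro e ⟨W', q, -, -, -, rfl⟩
    exact Real.iSup_nonneg fun x => Real.sqrt_nonneg _
  have hsup : ⨆ x, cPD (W x) (fun _ => (Fintype.card Y : ℝ)⁻¹) ≤
      1 - (2 * Fintype.card Y : ℝ)⁻¹ := by
    refine ciSup_le fun x => Real.sqrt_le_iff.2 ⟨?_, ?_⟩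
    all_goals
      have hc : (Fintype.card Y : ℝ)⁻¹ ≤ 1 :=
        inv_le_one_of_one_le₀ (by exact_mod_cast Fintype.card_pos)
      have hF := inv_card_le_cFid_uniform (hW x)
      rw [mul_inv]
    · linarith
    · nlinarith [sq_nonneg (Fintype.card Y : ℝ)⁻¹]
  linarith

/-- If every output distribution leaves some input with small Rényi overlap, then the
simulation error is close to one. -/
theorem one_sub_cEpsNS_le [Nonempty Y] {W : X → Y → ℝ} (hW : IsChannel W)
    {α M G : ℝ} (hα2 : 1 / 2 ≤ α) (hα : α < 1) (hM : 1 ≤ M)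
    (hG : ∀ q : Y → ℝ, IsProbDist q → ∃ x, ∑ y, W x y ^ α * q y ^ (1 - α) ≤ G) :
    1 - cEpsNS W M ≤ (M ^ (1 - α) * G) ^ (1 / α) := by
  have hα0 : 0 < α := by linarith
  suffices h : 1 - (M ^ (1 - α) * G) ^ (1 / α) ≤ cEpsNS W M by linarith
  refine le_csInf ⟨_, exists_uniform_mem W hM⟩ ?_
  rintro e ⟨W', q, hW', hq, hle, rfl⟩
  obtain ⟨x, hx⟩ := hG q hq
  have h1 := one_sub_cPD_le_cFid (cFid_le_one (hW x) (hW' x))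
  have h2 := cFid_le hα2 hα (by linarith) (hW x).1 (hW' x) hq.1 (hle x)
  have h0 : 0 ≤ ∑ y, W x y ^ α * q y ^ (1 - α) := Finset.sum_nonneg fun y _ =>
    mul_nonneg (Real.rpow_nonneg ((hW x).1 y) _) (Real.rpow_nonneg (hq.1 y) _)
  have h3 : (M ^ (1 - α) * ∑ y, W x y ^ α * q y ^ (1 - α)) ^ (1 / α) ≤
      (M ^ (1 - α) * G) ^ (1 / α) := by
    refine Real.rpow_le_rpow (by positivity) ?_ (by positivity)
    exact mul_le_mul_of_nonneg_left hx (by positivity)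
  have h4 : cPD (W x) (W' x) ≤ ⨆ x, cPD (W x) (W' x) :=
    le_ciSup (f := fun x => cPD (W x) (W' x)) (Set.finite_range _).bddAbove x
  linarith

end SingleLetter

section Product

variable {X Y : Type*} [Fintype Y]

theorem prodChannel_isChannel {W : X → Y → ℝ} (hW : IsChannel W) (n : ℕ) :
    IsChannel (prodChannel W n) := fun xs =>
  ⟨fun ys => Finset.prod_nonneg fun i _ => (hW (xs i)).1 (ys i), by
    simp only [prodChannel]
    rw [← Fintype.prod_sum fun i y => W (xs i) y]
    simp [(hW _).2]⟩

/-- Multiplicativity of the optimal Rényi overlap over product channels. -/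
theorem exists_prodChannel_sum_le {W : X → Y → ℝ} (hW : IsChannel W) {α G : ℝ}
    (hα0 : 0 ≤ α) (hα : α < 1) (hG0 : 0 ≤ G)
    (hG : ∀ q : Y → ℝ, (∀ y, 0 ≤ q y) →
      ∃ x, ∑ y, W x y ^ α * q y ^ (1 - α) ≤ G * (∑ y, q y) ^ (1 - α))
    (n : ℕ) (q : (Fin n → Y) → ℝ) (hq : ∀ ys, 0 ≤ q ys) :
    ∃ xs, ∑ ys, prodChannel W n xs ys ^ α * q ys ^ (1 - α) ≤
      G ^ n * (∑ ys, q ys) ^ (1 - α) := by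
  have h1 : 0 < 1 - α := by linarith
  induction n with
  | zero => exact ⟨Fin.elim0, by simp [prodChannel]⟩
  | succ n ih =>
    have hsum : ∀ f : (Fin (n + 1) → Y) → ℝ,
        ∑ ys, f ys = ∑ y, ∑ zs : Fin n → Y, f (Fin.cons y zs) := fun f => by
      rw [← (Fin.consEquiv fun _ => Y).sum_comp, Fintype.sum_prod_type]
      rfl
    obtain ⟨x, hx⟩ := hG (fun y => ∑ zs : Fin n → Y, q (Fin.cons y zs))
      fun y => Finset.sum_nonneg fun zs _ => hq _
    have hWn : ∀ y, 0 ≤ W x y ^ α := fun y => Real.rpow_nonneg ((hW x).1 y) _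
    have hs : ∀ zs : Fin n → Y, 0 ≤ ∑ y, W x y ^ α * q (Fin.cons y zs) ^ (1 - α) := fun zs =>
      Finset.sum_nonneg fun y _ => mul_nonneg (hWn y) (Real.rpow_nonneg (hq _) _)
    set h : (Fin n → Y) → ℝ := fun zs =>
      (∑ y, W x y ^ α * q (Fin.cons y zs) ^ (1 - α)) ^ (1 / (1 - α)) with hh
    have hcancel : ∀ {a : ℝ}, 0 ≤ a → (a ^ (1 / (1 - α))) ^ (1 - α) = a := fun {a} ha => by
      rw [← Real.rpow_mul ha, one_div_mul_cancel h1.ne', Real.rpow_one]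
    have hcancel' : ∀ {a : ℝ}, 0 ≤ a → (a ^ (1 - α)) ^ (1 / (1 - α)) = a := fun {a} ha => by
      rw [← Real.rpow_mul ha, mul_one_div_cancel h1.ne', Real.rpow_one]
    obtain ⟨xs, hxs⟩ := ih h fun zs => Real.rpow_nonneg (hs zs) _
    have hmink : (∑ zs, h zs) ^ (1 - α) ≤ G * (∑ ys, q ys) ^ (1 - α) := by
      rw [hsum q]
      refine le_trans ?_ hx
      have hM := Lp_sum_le (t := 1 / (1 - α)) ((one_le_div h1).2 (by linarith))
        (fun (y : Y) (zs : Fin n → Y) => W x y ^ α * q (Fin.cons y zs) ^ (1 - α))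
        fun y zs => mul_nonneg (hWn y) (Real.rpow_nonneg (hq _) _)
      rw [one_div_one_div] at hM
      refine hM.trans_eq (Finset.sum_congr rfl fun y _ => ?_)
      simp only [Real.mul_rpow (hWn y) (Real.rpow_nonneg (hq _) _), hcancel' (hq _)]
      rw [← Finset.mul_sum, Real.mul_rpow (Real.rpow_nonneg (hWn y) _)
        (Finset.sum_nonneg fun zs _ => hq _), hcancel (hWn y)]
    refine ⟨Fin.cons x xs, ?_⟩
    calc ∑ ys, prodChannel W (n + 1) (Fin.cons x xs) ys ^ α * q ys ^ (1 - α)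
        = ∑ zs, prodChannel W n xs zs ^ α * h zs ^ (1 - α) := by
          rw [hsum, Finset.sum_comm]
          refine Finset.sum_congr rfl fun zs _ => ?_
          rw [hh]
          simp only []
          rw [hcancel (hs zs), Finset.mul_sum]
          refine Finset.sum_congr rfl fun y _ => ?_
          have : prodChannel W (n + 1) (Fin.cons x xs) (Fin.cons y zs) =
              W x y * prodChannel W n xs zs := by
            simp [prodChannel, Fin.prod_univ_succ]
          rw [this, Real.mul_rpow ((hW x).1 y) ((prodChannel_isChannel hW n xs).1 zs)]
          ring
      _ ≤ G ^ n * (∑ zs, h zs) ^ (1 - α) := hxs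
      _ ≤ G ^ n * (G * (∑ ys, q ys) ^ (1 - α)) :=
          mul_le_mul_of_nonneg_left hmink (pow_nonneg hG0 n)
      _ = _ := by ring

theorem one_sub_cEpsNS_prodChannel_le [Fintype X] [Nonempty X] {W : X → Y → ℝ}
    (hW : IsChannel W) {r : ℝ} (hr : 0 ≤ r) (n : ℕ) {α : ℝ} (hα2 : 1 / 2 ≤ α) (hα : α ≤ 1) :
    1 - cEpsNS (prodChannel W n) (Real.exp (n * r)) ≤
      Real.exp (-(n : ℝ) * ((1 - α) / α) * ((cRenyiMI α W).toReal - r)) := by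
  have : Nonempty Y := (hW (Classical.arbitrary X)).nonempty
  have hα0 : 0 < α := by linarith
  rcases hα.eq_or_lt with rfl | hα
  · simpa using cEpsNS_nonneg (prodChannel W n) (Real.exp (n * r))
  set I := (cRenyiMI α W).toReal
  have := one_sub_cEpsNS_le (prodChannel_isChannel hW n) (M := Real.exp (n * r))
    (G := Real.exp (-(1 - α) * I) ^ n) hα2 hα (Real.one_le_exp (by positivity)) fun q hq => by
      simpa [hq.2] using exists_prodChannel_sum_le hW hα0.le hα (Real.exp_pos _).le
        (fun q hq => exists_sum_le_of_nonneg hα0.le hα hW hq) n q hq.1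
  refine this.trans_eq ?_
  rw [← Real.exp_nat_mul, ← Real.exp_mul, ← Real.exp_add, ← Real.exp_mul]
  congr 1
  field_simp
  ring

end Product

end ChannelSim

open ChannelSim in
/-- converse bound on the strong converse exponent for non-signaling assisted
classical channel simulation. -/
theorem statement1 {X Y : Type*} [Fintype X] [Nonempty X] [Fintype Y]
    (W : X → Y → ℝ) (hW : IsChannel W) (r : ℝ) (hr : 0 ≤ r) :
    (∀ n : ℕ, ∀ α : ℝ, 1 / 2 ≤ α → α ≤ 1 →
      1 - cEpsNS (prodChannel W n) (Real.exp (n * r)) ≤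
        Real.exp (-(n : ℝ) * ((1 - α) / α) * ((cRenyiMI α W).toReal - r))) ∧
    (⨆ α : {a : ℝ // 1 / 2 ≤ a ∧ a ≤ 1},
        ((1 - α.1) / α.1) * ((cRenyiMI α.1 W).toReal - r)) ≤
      Filter.liminf
        (fun n : ℕ => -(1 / (n : ℝ)) *
          Real.log (1 - cEpsNS (prodChannel W n) (Real.exp (n * r)))) Filter.atTop := by
  refine ⟨fun n α h2 h1 => one_sub_cEpsNS_prodChannel_le hW hr n h2 h1, ?_⟩
  have : Nonempty Y := (hW (Classical.arbitrary X)).nonempty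
  have : Nonempty {a : ℝ // 1 / 2 ≤ a ∧ a ≤ 1} := ⟨⟨1, by norm_num⟩⟩
  have hlow (n : ℕ) : (2 * (Fintype.card Y : ℝ) ^ n)⁻¹ ≤
      1 - cEpsNS (prodChannel W n) (Real.exp (n * r)) := by
    simpa using cEpsNS_le (prodChannel_isChannel hW n)
      (Real.one_le_exp (show 0 ≤ (n : ℝ) * r by positivity))
  have hc : (1 : ℝ) ≤ Fintype.card Y := by exact_mod_cast Fintype.card_pos
  have hpos (n : ℕ) : 0 < 1 - cEpsNS (prodChannel W n) (Real.exp (n * r)) :=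
    lt_of_lt_of_le (by positivity) (hlow n)
  refine ciSup_le fun α => Filter.le_liminf_of_le ?_ ?_
  · refine Filter.IsBoundedUnder.isCoboundedUnder_ge
      ⟨Real.log 2 + Real.log (Fintype.card Y), Filter.eventually_map.2 ?_⟩
    filter_upwards [Filter.eventually_ge_atTop 1] with n hn
    have hn1 : (1 : ℝ) ≤ n := by exact_mod_cast hn
    have hlog := Real.log_le_log (by positivity) (hlow n)
    rw [Real.log_inv, Real.log_mul two_ne_zero (by positivity), Real.log_pow] at hlog
    have hl2 : 0 ≤ Real.log 2 := Real.log_nonneg one_le_two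
    rw [neg_mul, ← mul_neg, one_div, inv_mul_le_iff₀ (by positivity)]
    nlinarith
  · filter_upwards [Filter.eventually_ge_atTop 1] with n hn
    have hn0 : (0 : ℝ) < n := by exact_mod_cast hn
    have hlog := (Real.log_le_iff_le_exp (hpos n)).2
      (one_sub_cEpsNS_prodChannel_le hW hr n α.2.1 α.2.2)
    rw [neg_mul, ← mul_neg, one_div (n : ℝ), le_inv_mul_iff₀ hn0]
    linarith
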